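/- arXiv:1701.05538 — 2 statements merged into one kernel-verified Lean document; each statement's English description precedes it below -/
import Mathlib

section
/- (Frostman) Let φ be an inner function on the open unit disc 𝔻 and let ε > 0. Then there exists a Blaschke product B such that sup_{z ∈ 𝔻} |φ(z) − B(z)| < ε. Consequently, the Blaschke products are dense in the set of inner functions in the supremum norm, and the set of inner functions is closed in the supremum norm. -/
open Complex Metric Set Filter MeasureTheory
open scoped Topology Real

/-- A (possibly infinite) Blaschke product
`c z^m ∏ᵢ (|aᵢ|/aᵢ)·(aᵢ - z)/(1 - conj aᵢ · z)`. -/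
noncomputable def blaschkeProd (m : ℕ) (c : ℂ) {ι : Type} (a : ι → ℂ) : ℂ → ℂ :=
  fun z => c * z ^ m *
    ∏' i, ((‖a i‖ : ℂ) / a i) * ((a i - z) / (1 - (starRingEnd ℂ) (a i) * z))

/-- `f` is a Blaschke product on the set `s`: it agrees there with
`c z^m ∏ᵢ (|aᵢ|/aᵢ)(aᵢ - z)/(1 - conj aᵢ z)` where `|c| = 1`, the `aᵢ` form a (finite or
countable) family of nonzero points of the open unit disc satisfying the Blaschke condition
`∑ᵢ (1 - |aᵢ|) < ∞`. -/
def IsBlaschkeProductOn (f : ℂ → ℂ) (s : Set ℂ) : Prop :=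
  ∃ (m : ℕ) (c : ℂ) (ι : Type) (_ : Countable ι) (a : ι → ℂ),
    ‖c‖ = 1 ∧ (∀ i, a i ≠ 0 ∧ ‖a i‖ < 1) ∧
    Summable (fun i => 1 - ‖a i‖) ∧
    Set.EqOn f (blaschkeProd m c a) s

/-- `φ` is an inner function: a bounded holomorphic function on the open unit disc whose radial
boundary values have modulus one almost everywhere. -/
def IsInner (φ : ℂ → ℂ) : Prop :=
  DifferentiableOn ℂ φ (ball (0:ℂ) 1) ∧
  (∃ C : ℝ, ∀ z ∈ ball (0:ℂ) 1, ‖φ z‖ ≤ C) ∧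
  ∀ᵐ (θ : ℝ) ∂(volume.restrict (Set.Ioc (0:ℝ) (2*π))),
    ∃ L : ℂ, ‖L‖ = 1 ∧
      Tendsto (fun r : ℝ => φ ((r : ℂ) * Complex.exp ((θ : ℂ) * Complex.I)))
        (𝓝[<] (1:ℝ)) (𝓝 L)

/-- The disc automorphism exchanging `a` and `0`. -/
noncomputable def discInvolution (a z : ℂ) : ℂ := (a - z) / (1 - (starRingEnd ℂ) a * z)

/-- The normalized Blaschke factor with zero `a`. -/
noncomputable def blaschkeFactor (a z : ℂ) : ℂ :=
  ((‖a‖ : ℂ) / a) * ((a - z) / (1 - (starRingEnd ℂ) a * z))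

lemma one_sub_conj_mul_ne_zero {a z : ℂ} (ha : ‖a‖ < 1) (hz : ‖z‖ ≤ 1) :
    1 - (starRingEnd ℂ) a * z ≠ 0 := by
  intro h
  have h1 : ‖(starRingEnd ℂ) a * z‖ = 1 := by rw [← sub_eq_zero.1 h, norm_one]
  rw [norm_mul, RCLike.norm_conj] at h1
  nlinarith [norm_nonneg a, norm_nonneg z]

lemma norm_sq_one_sub_conj_mul_sub (a z : ℂ) :
    ‖1 - (starRingEnd ℂ) a * z‖ ^ 2 - ‖a - z‖ ^ 2 = (1 - ‖a‖ ^ 2) * (1 - ‖z‖ ^ 2) := by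
  simp only [← Complex.normSq_eq_norm_sq, Complex.normSq_apply, sub_re, sub_im, mul_re, mul_im,
    conj_re, conj_im, one_re, one_im]
  ring

lemma norm_sub_le_norm_one_sub_conj_mul {a z : ℂ} (ha : ‖a‖ ≤ 1) (hz : ‖z‖ ≤ 1) :
    ‖a - z‖ ≤ ‖1 - (starRingEnd ℂ) a * z‖ := by
  have h := norm_sq_one_sub_conj_mul_sub a z
  have : 0 ≤ (1 - ‖a‖ ^ 2) * (1 - ‖z‖ ^ 2) :=
    mul_nonneg (by nlinarith [norm_nonneg a]) (by nlinarith [norm_nonneg z])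
  exact le_of_sq_le_sq (by linarith) (norm_nonneg _)

lemma norm_discInvolution_le_one {a z : ℂ} (ha : ‖a‖ ≤ 1) (hz : ‖z‖ ≤ 1) :
    ‖discInvolution a z‖ ≤ 1 := by
  rw [discInvolution, norm_div]
  exact div_le_one_of_le₀ (norm_sub_le_norm_one_sub_conj_mul ha hz) (norm_nonneg _)

lemma norm_discInvolution_lt_one {a z : ℂ} (ha : ‖a‖ < 1) (hz : ‖z‖ < 1) :
    ‖discInvolution a z‖ < 1 := by
  rw [discInvolution, norm_div,
    div_lt_one (norm_pos_iff.2 (one_sub_conj_mul_ne_zero ha hz.le))]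
  have h := norm_sq_one_sub_conj_mul_sub a z
  have : 0 < (1 - ‖a‖ ^ 2) * (1 - ‖z‖ ^ 2) :=
    mul_pos (by nlinarith [norm_nonneg a]) (by nlinarith [norm_nonneg z])
  exact lt_of_pow_lt_pow_left₀ 2 (norm_nonneg _) (by linarith)

lemma discInvolution_discInvolution {a z : ℂ} (ha : ‖a‖ < 1) (hz : ‖z‖ < 1) :
    discInvolution a (discInvolution a z) = z := by
  have h1 := one_sub_conj_mul_ne_zero ha hz.le
  have h2 := one_sub_conj_mul_ne_zero ha (norm_discInvolution_lt_one ha hz).le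
  rw [discInvolution, div_eq_iff h2, discInvolution]
  obtain ⟨d, hd⟩ : ∃ d, d = 1 - (starRingEnd ℂ) a * z := ⟨_, rfl⟩
  rw [← hd] at h1 ⊢
  field_simp
  rw [hd]
  ring

lemma differentiableOn_discInvolution {a : ℂ} (ha : ‖a‖ < 1) :
    DifferentiableOn ℂ (discInvolution a) (closedBall 0 1) := by
  unfold discInvolution
  refine DifferentiableOn.div (by fun_prop) (by fun_prop) fun z hz => ?_
  exact one_sub_conj_mul_ne_zero ha (by simpa using hz)

lemma norm_blaschkeFactor {a : ℂ} (ha : a ≠ 0) (z : ℂ) :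
    ‖blaschkeFactor a z‖ = ‖discInvolution a z‖ := by
  rw [blaschkeFactor, discInvolution, norm_mul]
  simp [ha]

lemma blaschkeFactor_zero {a : ℂ} (ha : a ≠ 0) : blaschkeFactor a 0 = ‖a‖ := by
  simp [blaschkeFactor, ha]

lemma differentiableOn_blaschkeFactor {a : ℂ} (ha : ‖a‖ < 1) :
    DifferentiableOn ℂ (blaschkeFactor a) (ball 0 1) :=
  ((differentiableOn_discInvolution ha).mono ball_subset_closedBall).const_mul _

/-- The Schwarz–Pick bound at a zero of a self-map of the disc. -/
lemma norm_le_norm_discInvolution_of_eq_zero {g : ℂ → ℂ} {a z : ℂ}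
    (hg : DifferentiableOn ℂ g (ball 0 1)) (hb : ∀ w ∈ ball (0 : ℂ) 1, ‖g w‖ ≤ 1)
    (ha : ‖a‖ < 1) (h0 : g a = 0) (hz : ‖z‖ < 1) : ‖g z‖ ≤ ‖discInvolution a z‖ := by
  have hmaps : MapsTo (discInvolution a) (ball 0 1) (ball 0 1) := fun w hw => by
    simpa using norm_discInvolution_lt_one ha (by simpa using hw)
  have key := norm_le_norm_of_mapsTo_ball (f := g ∘ discInvolution a) (R := 1)
    (z := discInvolution a z)
    (hg.comp ((differentiableOn_discInvolution ha).mono ball_subset_closedBall) hmaps)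
    (fun w hw => by simpa using hb _ (hmaps hw)) (by simp [discInvolution, h0])
    (norm_discInvolution_lt_one ha hz)
  simpa [discInvolution_discInvolution ha hz] using key

/-- A zero of a holomorphic self-map of the disc can be divided out by a Blaschke factor. -/
lemma exists_eq_blaschkeFactor_mul {g : ℂ → ℂ} {a : ℂ}
    (hg : DifferentiableOn ℂ g (ball 0 1)) (hb : ∀ w ∈ ball (0 : ℂ) 1, ‖g w‖ ≤ 1)
    (ha : ‖a‖ < 1) (ha0 : a ≠ 0) (h0 : g a = 0) :
    ∃ h : ℂ → ℂ, DifferentiableOn ℂ h (ball 0 1) ∧ (∀ w ∈ ball (0 : ℂ) 1, ‖h w‖ ≤ 1) ∧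
      ∀ w ∈ ball (0 : ℂ) 1, g w = blaschkeFactor a w * h w := by
  have ha' : a ∈ ball (0 : ℂ) 1 := by simpa using ha
  have hn : (‖a‖ : ℂ) ≠ 0 := by simpa using ha0
  set h : ℂ → ℂ := fun w => dslope g a w * (1 - (starRingEnd ℂ) a * w) * (-(a / ‖a‖)) with hh
  have hd : DifferentiableOn ℂ h (ball 0 1) := by
    have : DifferentiableOn ℂ (dslope g a) (ball 0 1) :=
      (differentiableOn_dslope (isOpen_ball.mem_nhds ha')).2 hg
    exact (this.mul (by fun_prop)).mul (by fun_prop)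
  have heq : ∀ w ∈ ball (0 : ℂ) 1, g w = blaschkeFactor a w * h w := by
    intro w hw
    have h1 := one_sub_conj_mul_ne_zero ha (by simpa using (mem_ball.1 hw).le : ‖w‖ ≤ 1)
    have h2 : (w - a) * dslope g a w = g w := by
      simpa [h0] using sub_smul_dslope g a w
    simp only [← h2, blaschkeFactor, hh]
    generalize 1 - (starRingEnd ℂ) a * w = d at h1
    field_simp
    ring
  have hne : ∀ w ∈ ball (0 : ℂ) 1, w ≠ a → ‖h w‖ ≤ 1 := by
    intro w hw hwa
    have hw' : ‖w‖ < 1 := by simpa using hw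
    have h1 := norm_le_norm_discInvolution_of_eq_zero hg hb ha h0 hw'
    rw [heq w hw, norm_mul, norm_blaschkeFactor ha0] at h1
    have h2 : 0 < ‖discInvolution a w‖ := by
      rw [norm_pos_iff, discInvolution]
      exact div_ne_zero (sub_ne_zero.2 hwa.symm) (one_sub_conj_mul_ne_zero ha hw'.le)
    nlinarith
  refine ⟨h, hd, fun w hw => ?_, heq⟩
  by_cases hwa : w = a
  · subst hwa
    have hc : Tendsto (fun x => ‖h x‖) (𝓝[≠] w) (𝓝 ‖h w‖) :=
      ((hd.continuousOn.continuousAt (isOpen_ball.mem_nhds hw)).norm.tendsto).mono_left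
        nhdsWithin_le_nhds
    refine le_of_tendsto hc ?_
    filter_upwards [self_mem_nhdsWithin, nhdsWithin_le_nhds (isOpen_ball.mem_nhds hw)] with x h1 h2
    exact hne x h2 h1
  · exact hne w hw hwa

lemma eqOn_const_of_norm_eq_one {g : ℂ → ℂ} {c : ℂ} (hg : DifferentiableOn ℂ g (ball 0 1))
    (hb : ∀ w ∈ ball (0 : ℂ) 1, ‖g w‖ ≤ 1) (hc : c ∈ ball (0 : ℂ) 1) (h1 : ‖g c‖ = 1) :
    ∀ z ∈ ball (0 : ℂ) 1, g z = g c :=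
  eqOn_of_isPreconnected_of_isMaxOn_norm (convex_ball _ _).isPreconnected isOpen_ball hg hc
    fun w hw => by simpa [h1] using hb w hw

/-- A self-map of the disc whose value at the origin is nearly unimodular is nearly constant. -/
lemma norm_sub_mul_one_sub_norm_le {g : ℂ → ℂ} {z : ℂ}
    (hg : DifferentiableOn ℂ g (ball 0 1)) (hb : ∀ w ∈ ball (0 : ℂ) 1, ‖g w‖ ≤ 1)
    (hz : ‖z‖ < 1) : ‖g z - g 0‖ * (1 - ‖z‖) ≤ 2 * (1 - ‖g 0‖) := by
  have h0 : ‖g 0‖ ≤ 1 := hb 0 (by simp)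
  have hz' : z ∈ ball (0 : ℂ) 1 := by simpa using hz
  rcases h0.eq_or_lt with h0 | h0
  · rw [eqOn_const_of_norm_eq_one hg hb (by simp) h0 z hz', h0]
    simp
  have key := norm_le_norm_of_mapsTo_ball (f := discInvolution (g 0) ∘ g) (R := 1) (z := z)
    ((differentiableOn_discInvolution h0).comp hg fun w hw => by simpa using hb w hw)
    (fun w hw => by simpa using norm_discInvolution_le_one h0.le (hb w hw))
    (by simp [discInvolution]) hz
  have hne := norm_pos_iff.2 (one_sub_conj_mul_ne_zero h0 (hb z hz'))
  rw [Function.comp, discInvolution, norm_div, div_le_iff₀ hne] at key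
  have h2 : ‖1 - (starRingEnd ℂ) (g 0) * g z‖ ≤ (1 - ‖g 0‖ ^ 2) + ‖g 0‖ * ‖g 0 - g z‖ := by
    have : 1 - (starRingEnd ℂ) (g 0) * g z =
        ((1 - ‖g 0‖ ^ 2 : ℝ) : ℂ) + (starRingEnd ℂ) (g 0) * (g 0 - g z) := by
      push_cast
      rw [mul_sub, ← Complex.conj_mul']
      ring
    rw [this]
    refine (norm_add_le _ _).trans ?_
    rw [norm_mul, RCLike.norm_conj, Complex.norm_real, Real.norm_of_nonneg]
    nlinarith [norm_nonneg (g 0)]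
  rw [norm_sub_rev]
  have h3 := norm_nonneg (g 0)
  have h4 := norm_nonneg z
  have h5 := norm_nonneg (g 0 - g z)
  have h6 : ‖g 0‖ * ‖g 0 - g z‖ ≤ ‖g 0 - g z‖ := mul_le_of_le_one_left h5 h0.le
  have h7 : ‖z‖ * ‖1 - (starRingEnd ℂ) (g 0) * g z‖ ≤ ‖z‖ * ((1 - ‖g 0‖ ^ 2) + ‖g 0 - g z‖) :=
    mul_le_mul_of_nonneg_left (by linarith) h4
  have h8 : ‖z‖ * (1 - ‖g 0‖ ^ 2) ≤ 1 - ‖g 0‖ ^ 2 :=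
    mul_le_of_le_one_left (by nlinarith) hz.le
  nlinarith

lemma analyticOrderAt_blaschkeFactor {a b : ℂ} (ha0 : a ≠ 0) (ha : ‖a‖ < 1) (hb : ‖b‖ < 1) :
    analyticOrderAt (blaschkeFactor a) b = if a = b then 1 else 0 := by
  have han : AnalyticAt ℂ (blaschkeFactor a) b :=
    (differentiableOn_blaschkeFactor ha).analyticAt (isOpen_ball.mem_nhds (by simpa using hb))
  split_ifs with h
  · subst h
    have hne := one_sub_conj_mul_ne_zero ha ha.le
    have hu : AnalyticAt ℂ (fun z => -((‖a‖ : ℂ) / a) * (1 - (starRingEnd ℂ) a * z)⁻¹) a :=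
      analyticAt_const.mul (AnalyticAt.inv (by fun_prop) hne)
    have heq : blaschkeFactor a =
        (fun z => z - a) * (fun z => -((‖a‖ : ℂ) / a) * (1 - (starRingEnd ℂ) a * z)⁻¹) := by
      ext z
      simp only [blaschkeFactor, Pi.mul_apply, div_eq_mul_inv]
      ring
    rw [heq, analyticOrderAt_mul (by fun_prop) hu, hu.analyticOrderAt_eq_zero.2 (by simp [ha0, hne])]
    simp
  · refine han.analyticOrderAt_eq_zero.2 ?_
    rw [blaschkeFactor]
    exact mul_ne_zero (div_ne_zero (by simpa using ha0) ha0)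
      (div_ne_zero (sub_ne_zero.2 h) (one_sub_conj_mul_ne_zero ha hb.le))

/-- The zeros of `f` in the unit disc, repeated according to multiplicity. -/
def DiscZero (f : ℂ → ℂ) : Type :=
  {p : ℂ × ℕ // ‖p.1‖ < 1 ∧ p.2 < analyticOrderNatAt f p.1}

namespace DiscZero

variable {f : ℂ → ℂ}

/-- The underlying zero. -/
def point (i : DiscZero f) : ℂ := i.1.1

lemma norm_point_lt (i : DiscZero f) : ‖i.point‖ < 1 := i.2.1

lemma point_ne_zero (h0 : f 0 ≠ 0) (i : DiscZero f) : i.point ≠ 0 := by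
  intro h
  have h1 : analyticOrderNatAt f i.point ≠ 0 := (Nat.zero_le _).trans_lt i.2.2 |>.ne'
  rw [h] at h1
  exact h0 (apply_eq_zero_of_analyticOrderNatAt_ne_zero h1)

open Classical in
lemma card_filter_le (S : Finset (DiscZero f)) (b : ℂ) :
    (S.filter fun i => i.point = b).card ≤ analyticOrderNatAt f b := by
  rw [← Finset.card_range (analyticOrderNatAt f b)]
  refine Finset.card_le_card_of_injOn (fun i => i.1.2) ?_ ?_
  · intro i hi
    have h1 := (Finset.mem_filter.1 hi).2
    have h2 := i.2.2
    rw [Finset.coe_range, Set.mem_Iio, ← h1]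
    exact h2
  · intro i hi j hj hij
    have h1 := (Finset.mem_filter.1 hi).2
    have h2 := (Finset.mem_filter.1 hj).2
    exact Subtype.ext (Prod.ext (h1.trans h2.symm) hij)

end DiscZero

lemma analyticOrderAt_ne_top_of_apply_zero_ne {f : ℂ → ℂ} (hf : DifferentiableOn ℂ f (ball 0 1))
    (h0 : f 0 ≠ 0) {b : ℂ} (hb : b ∈ ball (0 : ℂ) 1) : analyticOrderAt f b ≠ ⊤ := by
  have han : AnalyticOnNhd ℂ f (ball 0 1) := hf.analyticOnNhd isOpen_ball
  refine han.analyticOrderAt_ne_top_of_isPreconnected (convex_ball _ _).isPreconnected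
    (x := 0) (by simp) hb ?_
  rw [(han 0 (by simp)).analyticOrderAt_eq_zero.2 h0]
  simp

open Classical in
/-- Any finite set of zeros of a holomorphic self-map of the disc can be divided out. -/
lemma exists_eq_prod_blaschkeFactor_mul {f : ℂ → ℂ} (hf : DifferentiableOn ℂ f (ball 0 1))
    (hb : ∀ w ∈ ball (0 : ℂ) 1, ‖f w‖ ≤ 1) (h0 : f 0 ≠ 0) (S : Finset (DiscZero f)) :
    ∃ g : ℂ → ℂ, DifferentiableOn ℂ g (ball 0 1) ∧ (∀ w ∈ ball (0 : ℂ) 1, ‖g w‖ ≤ 1) ∧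
      (∀ w ∈ ball (0 : ℂ) 1, f w = (∏ i ∈ S, blaschkeFactor i.point w) * g w) ∧
      ∀ b ∈ ball (0 : ℂ) 1, analyticOrderNatAt f b =
        (S.filter fun i => i.point = b).card + analyticOrderNatAt g b := by
  induction S using Finset.induction_on with
  | empty => exact ⟨f, hf, hb, by simp, by simp⟩
  | insert i S hi ih =>
    obtain ⟨g, hg, hgb, hfg, hord⟩ := ih
    have hia : i.point ∈ ball (0 : ℂ) 1 := by simpa using i.norm_point_lt
    have hi0 := i.point_ne_zero h0
    have hg0 : g i.point = 0 := by
      apply apply_eq_zero_of_analyticOrderNatAt_ne_zero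
      have h1 := hord _ hia
      have h2 := DiscZero.card_filter_le (insert i S) i.point
      rw [Finset.filter_insert, if_pos rfl, Finset.card_insert_of_notMem (by simp [hi])] at h2
      omega
    obtain ⟨h, hh, hhb, hgh⟩ := exists_eq_blaschkeFactor_mul hg hgb i.norm_point_lt hi0 hg0
    have hfh : ∀ w ∈ ball (0 : ℂ) 1,
        f w = (∏ j ∈ insert i S, blaschkeFactor j.point w) * h w := fun w hw => by
      rw [Finset.prod_insert hi, hfg w hw, hgh w hw]
      ring
    refine ⟨h, hh, hhb, hfh, fun b hbb => ?_⟩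
    have hh0 : h 0 ≠ 0 := by
      have := hfh 0 (by simp)
      intro h'
      rw [h', mul_zero] at this
      exact h0 this
    have hbn : ‖b‖ < 1 := by simpa using hbb
    have hbo := analyticOrderAt_blaschkeFactor hi0 i.norm_point_lt hbn
    have hgo : analyticOrderNatAt g b =
        analyticOrderNatAt (blaschkeFactor i.point) b + analyticOrderNatAt h b := by
      rw [← analyticOrderNatAt_mul
        ((differentiableOn_blaschkeFactor i.norm_point_lt).analyticAt (isOpen_ball.mem_nhds hbb))
        (hh.analyticAt (isOpen_ball.mem_nhds hbb)) (by rw [hbo]; split_ifs <;> simp)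
        (analyticOrderAt_ne_top_of_apply_zero_ne hh hh0 hbb)]
      unfold analyticOrderNatAt
      rw [analyticOrderAt_congr]
      filter_upwards [isOpen_ball.mem_nhds hbb] with w hw using hgh w hw
    rw [hord b hbb, hgo, analyticOrderNatAt, hbo, Finset.filter_insert]
    split_ifs with hib
    · rw [Finset.card_insert_of_notMem (by simp [hi])]
      simp
      ring
    · simp

open Classical in
/-- Once all zeros in a set are divided out, the quotient has no zero there. -/
lemma apply_ne_zero_of_analyticOrderNatAt_eq {f g : ℂ → ℂ} {b : ℂ} {S : Finset (DiscZero f)}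
    (hg : DifferentiableOn ℂ g (ball 0 1)) (hg0 : g 0 ≠ 0) (hb : b ∈ ball (0 : ℂ) 1)
    (hord : analyticOrderNatAt f b =
      (S.filter fun i => i.point = b).card + analyticOrderNatAt g b)
    (hS : ∀ i : DiscZero f, i.point = b → i ∈ S) : g b ≠ 0 := by
  intro h
  have han : AnalyticAt ℂ g b := hg.analyticAt (isOpen_ball.mem_nhds hb)
  have h1 := han.analyticOrderAt_ne_zero.2 h
  have h2 := Nat.cast_analyticOrderNatAt (analyticOrderAt_ne_top_of_apply_zero_ne hg hg0 hb)
  have h3 : analyticOrderNatAt g b ≠ 0 := by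
    intro h4
    rw [h4] at h2
    exact h1 h2.symm
  have hbn : ‖b‖ < 1 := by simpa using hb
  have h5 : analyticOrderNatAt f b ≤ (S.filter fun i => i.point = b).card := by
    have : (Finset.univ : Finset (Fin (analyticOrderNatAt f b))).card ≤
        (S.filter fun i => i.point = b).card := by
      refine Finset.card_le_card_of_injOn
        (fun k => (⟨(b, k), hbn, k.2⟩ : DiscZero f)) (fun k _ => ?_) fun k _ l _ hkl => ?_
      · simp only [Finset.coe_filter]
        exact ⟨hS _ rfl, rfl⟩
      · simpa [Fin.ext_iff] using congrArg (fun i : DiscZero f => i.1.2) hkl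
    simpa using this
  omega

lemma norm_prod_blaschkeFactor_le_one {f : ℂ → ℂ} (h0 : f 0 ≠ 0) (S : Finset (DiscZero f)) {z : ℂ}
    (hz : ‖z‖ ≤ 1) : ‖∏ i ∈ S, blaschkeFactor i.point z‖ ≤ 1 := by
  rw [norm_prod]
  refine Finset.prod_le_one (fun _ _ => norm_nonneg _) fun i _ => ?_
  rw [norm_blaschkeFactor (i.point_ne_zero h0)]
  exact norm_discInvolution_le_one i.norm_point_lt.le hz

lemma prod_blaschkeFactor_zero {f : ℂ → ℂ} (h0 : f 0 ≠ 0) (S : Finset (DiscZero f)) :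
    ∏ i ∈ S, blaschkeFactor i.point 0 = ((∏ i ∈ S, ‖i.point‖ : ℝ) : ℂ) := by
  push_cast
  exact Finset.prod_congr rfl fun i _ => blaschkeFactor_zero (i.point_ne_zero h0)

/-- The Blaschke condition for bounded holomorphic functions. -/
lemma summable_one_sub_norm_point {f : ℂ → ℂ} (hf : DifferentiableOn ℂ f (ball 0 1))
    (hb : ∀ w ∈ ball (0 : ℂ) 1, ‖f w‖ ≤ 1) (h0 : f 0 ≠ 0) :
    Summable fun i : DiscZero f => 1 - ‖i.point‖ := by
  refine summable_of_sum_le (c := -Real.log ‖f 0‖)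
    (fun i => by simpa using i.norm_point_lt.le) fun S => ?_
  obtain ⟨g, -, hgb, hfg, -⟩ := exists_eq_prod_blaschkeFactor_mul hf hb h0 S
  have h1 : ‖f 0‖ ≤ ∏ i ∈ S, ‖i.point‖ := by
    rw [hfg 0 (by simp), prod_blaschkeFactor_zero h0, norm_mul, Complex.norm_real,
      Real.norm_of_nonneg (Finset.prod_nonneg fun _ _ => norm_nonneg _)]
    exact mul_le_of_le_one_right (Finset.prod_nonneg fun _ _ => norm_nonneg _) (hgb 0 (by simp))
  have h2 := Real.log_le_log (norm_pos_iff.2 h0) h1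
  have hpos : ∀ i : DiscZero f, 0 < ‖i.point‖ := fun i => norm_pos_iff.2 (i.point_ne_zero h0)
  rw [Real.log_prod (fun i _ => (hpos i).ne')] at h2
  have h3 : ∑ i ∈ S, Real.log ‖i.point‖ ≤ ∑ i ∈ S, (‖i.point‖ - 1) :=
    Finset.sum_le_sum fun i _ => Real.log_le_sub_one_of_pos (hpos i)
  have h4 : ∑ i ∈ S, (1 - ‖i.point‖) = -∑ i ∈ S, (‖i.point‖ - 1) := by
    rw [← Finset.sum_neg_distrib]
    simp
  linarith

/-- The extended real function `-log ‖w‖`, with the value `⊤` at `0`. -/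
noncomputable def negLogNorm (w : ℂ) : ENNReal :=
  open Classical in if w = 0 then ⊤ else ENNReal.ofReal (-Real.log ‖w‖)

lemma measurable_negLogNorm : Measurable negLogNorm := by
  unfold negLogNorm
  exact Measurable.ite (measurableSet_singleton 0) measurable_const (by fun_prop)

lemma ofReal_neg_log_le_negLogNorm (w : ℂ) : ENNReal.ofReal (-Real.log ‖w‖) ≤ negLogNorm w := by
  unfold negLogNorm
  split_ifs <;> simp

lemma circleMap_zero_mem_ball {r : ℝ} (h0 : 0 ≤ r) (h1 : r < 1) (θ : ℝ) :
    circleMap 0 r θ ∈ ball (0 : ℂ) 1 := by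
  simpa [norm_circleMap_zero, abs_of_nonneg h0] using h1

lemma continuous_comp_circleMap {E : Type*} [TopologicalSpace E] {f : ℂ → E} {r : ℝ}
    (hf : ContinuousOn f (ball 0 1)) (h0 : 0 ≤ r) (h1 : r < 1) :
    Continuous fun θ => f (circleMap 0 r θ) :=
  hf.comp_continuous (continuous_circleMap 0 r) (circleMap_zero_mem_ball h0 h1)

lemma neg_log_norm_apply_zero_le {g : ℂ → ℂ} {r ε : ℝ} (hg : DifferentiableOn ℂ g (ball 0 1))
    (hb : ∀ w ∈ ball (0 : ℂ) 1, ‖g w‖ ≤ 1) (hr0 : 0 < r) (hr1 : r < 1) (hε : 0 ≤ ε)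
    (hne : ∀ w ∈ closedBall (0 : ℂ) r, g w ≠ 0)
    (hmean : ∫⁻ θ in Ioc 0 (2 * π), negLogNorm (g (circleMap 0 r θ)) ≤
      ENNReal.ofReal (2 * π * ε)) :
    -Real.log ‖g 0‖ ≤ ε := by
  have hsub : closedBall (0 : ℂ) |r| ⊆ ball 0 1 := by
    rw [abs_of_pos hr0]
    exact closedBall_subset_ball hr1
  have hav : Real.circleAverage (Real.log ‖g ·‖) 0 r = Real.log ‖g 0‖ :=
    AnalyticOnNhd.circleAverage_log_norm_of_ne_zero ((hg.analyticOnNhd isOpen_ball).mono hsub)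
      (by rwa [abs_of_pos hr0])
  have hcont : Continuous fun θ => -Real.log ‖g (circleMap 0 r θ)‖ := by
    refine ((continuous_comp_circleMap hg.continuousOn hr0.le hr1).norm.log fun θ => ?_).neg
    exact norm_ne_zero_iff.2 (hne _ (by simp [abs_of_pos hr0]))
  have hpos : ∀ θ, 0 ≤ -Real.log ‖g (circleMap 0 r θ)‖ := fun θ =>
    neg_nonneg.2 (Real.log_nonpos (norm_nonneg _) (hb _ (circleMap_zero_mem_ball hr0.le hr1 θ)))
  have h1 : ∫ θ in Ioc 0 (2 * π), -Real.log ‖g (circleMap 0 r θ)‖ ≤ 2 * π * ε := by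
    rw [integral_eq_lintegral_of_nonneg_ae (Eventually.of_forall hpos)
      hcont.aestronglyMeasurable]
    refine ENNReal.toReal_le_of_le_ofReal (by positivity) (le_trans ?_ hmean)
    exact lintegral_mono fun θ => ofReal_neg_log_le_negLogNorm _
  rw [← hav, Real.circleAverage_def, intervalIntegral.integral_of_le (by positivity), smul_eq_mul]
  rw [integral_neg] at h1
  have hπ : 0 < 2 * π := by positivity
  rw [← mul_neg, inv_mul_le_iff₀ hπ]
  exact h1

/-- A holomorphic self-map of the disc not vanishing at the origin, whose logarithmic means on
circles are arbitrarily small, is a Blaschke product. -/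
lemma isBlaschkeProductOn_of_lintegral_negLogNorm_le {f : ℂ → ℂ}
    (hf : DifferentiableOn ℂ f (ball 0 1)) (hb : ∀ w ∈ ball (0 : ℂ) 1, ‖f w‖ ≤ 1) (h0 : f 0 ≠ 0)
    (hlim : ∀ ε : ℝ, 0 < ε → ∃ r : ℝ, 0 < r ∧ r < 1 ∧
      ∫⁻ θ in Ioc 0 (2 * π), negLogNorm (f (circleMap 0 r θ)) ≤ ENNReal.ofReal (2 * π * ε)) :
    IsBlaschkeProductOn f (ball 0 1) := by
  classical
  have hsum := summable_one_sub_norm_point hf hb h0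
  have hcount : Countable (DiscZero f) := by
    rw [← Set.countable_univ_iff]
    refine hsum.countable_support.mono fun i _ => ?_
    simpa [sub_eq_zero] using i.norm_point_lt.ne'
  set c : ℂ := f 0 / ‖f 0‖ with hc
  have hn0 : (‖f 0‖ : ℂ) ≠ 0 := by simpa using h0
  have hcn : ‖c‖ = 1 := by simp [hc, h0]
  have hc0 : c ≠ 0 := norm_ne_zero_iff.1 (by simp [hcn])
  refine ⟨0, c, DiscZero f, hcount, DiscZero.point, hcn,
    fun i => ⟨i.point_ne_zero h0, i.norm_point_lt⟩, hsum, fun z hz => ?_⟩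
  have hzn : ‖z‖ < 1 := by simpa using hz
  suffices h : HasProd (fun i : DiscZero f => blaschkeFactor i.point z) (f z / c) by
    have h' : ∏' i : DiscZero f, ((‖i.point‖ : ℂ) / i.point) *
        ((i.point - z) / (1 - (starRingEnd ℂ) i.point * z)) = f z / c := h.tprod_eq
    rw [blaschkeProd, h', pow_zero, mul_one, mul_div_cancel₀ _ hc0]
  have key : ∀ ε : ℝ, 0 < ε → ∀ᶠ S : Finset (DiscZero f) in atTop,
      ‖∏ i ∈ S, blaschkeFactor i.point z - f z / c‖ ≤ 2 * ε / (1 - ‖z‖) + ε := by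
    intro ε hε
    obtain ⟨r, hr0, hr1, hmean⟩ := hlim ε hε
    have hfin : {i : DiscZero f | ‖i.point‖ ≤ r}.Finite := by
      have := hsum.tendsto_cofinite_zero.eventually_lt_const (sub_pos.2 hr1)
      refine (eventually_cofinite.1 this).subset fun i hi => ?_
      simpa using hi
    filter_upwards [eventually_ge_atTop hfin.toFinset] with S hS
    obtain ⟨g, hg, hgb, hfg, hord⟩ := exists_eq_prod_blaschkeFactor_mul hf hb h0 S
    have hf0 := hfg 0 (by simp)
    have hg0 : g 0 ≠ 0 := fun h => h0 (by rw [hf0, h, mul_zero])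
    have hne : ∀ w ∈ closedBall (0 : ℂ) r, g w ≠ 0 := fun w hw =>
      apply_ne_zero_of_analyticOrderNatAt_eq hg hg0 (closedBall_subset_ball hr1 hw)
        (hord w (closedBall_subset_ball hr1 hw)) fun i hi => hS <| by
          simpa [hi] using hw
    have hlog : -Real.log ‖g 0‖ ≤ ε := by
      refine neg_log_norm_apply_zero_le hg hgb hr0 hr1 hε.le hne (le_trans ?_ hmean)
      refine lintegral_mono fun θ => ?_
      have hθ := circleMap_zero_mem_ball hr0.le hr1 θ
      have hgθ : g (circleMap 0 r θ) ≠ 0 := hne _ (by simp [abs_of_pos hr0])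
      have hle : ‖f (circleMap 0 r θ)‖ ≤ ‖g (circleMap 0 r θ)‖ := by
        rw [hfg _ hθ, norm_mul]
        exact mul_le_of_le_one_left (norm_nonneg _)
          (norm_prod_blaschkeFactor_le_one h0 S (by simpa using (mem_ball.1 hθ).le))
      by_cases hfθ : f (circleMap 0 r θ) = 0
      · simp [negLogNorm, hfθ]
      · simp only [negLogNorm, hgθ, hfθ, if_false]
        exact ENNReal.ofReal_le_ofReal
          (neg_le_neg (Real.log_le_log (norm_pos_iff.2 hfθ) hle))
    have hgn : 1 - ‖g 0‖ ≤ ε := by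
      have := Real.log_le_sub_one_of_pos (norm_pos_iff.2 hg0)
      have h2 := Real.add_one_le_exp (-ε)
      have h3 : Real.exp (-ε) ≤ ‖g 0‖ := by
        rw [← Real.le_log_iff_exp_le (norm_pos_iff.2 hg0)]
        linarith
      linarith
    have hgc : g 0 = c * ‖g 0‖ := by
      have hP : 0 < ∏ i ∈ S, ‖i.point‖ :=
        Finset.prod_pos fun i _ => norm_pos_iff.2 (i.point_ne_zero h0)
      rw [prod_blaschkeFactor_zero h0] at hf0
      have hPc : ((∏ i ∈ S, ‖i.point‖ : ℝ) : ℂ) ≠ 0 := by exact_mod_cast hP.ne'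
      have hnf : ‖f 0‖ = (∏ i ∈ S, ‖i.point‖) * ‖g 0‖ := by
        rw [hf0, norm_mul, Complex.norm_real, Real.norm_of_nonneg hP.le]
      rw [hc, hnf, hf0]
      have : (‖g 0‖ : ℂ) ≠ 0 := by simpa using hg0
      rw [Complex.ofReal_mul]
      field_simp
    have h1 : ‖g z - g 0‖ ≤ 2 * ε / (1 - ‖z‖) := by
      rw [le_div_iff₀ (sub_pos.2 hzn)]
      linarith [norm_sub_mul_one_sub_norm_le hg hgb hzn]
    have h2 : ‖g 0 - c‖ ≤ ε := by
      have : g 0 - c = c * ((‖g 0‖ - 1 : ℝ) : ℂ) := by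
        push_cast
        linear_combination hgc
      rw [this, norm_mul, hcn, one_mul, Complex.norm_real, Real.norm_eq_abs, abs_sub_comm,
        abs_of_nonneg (sub_nonneg.2 (hgb 0 (by simp)))]
      exact hgn
    have h3 : ∏ i ∈ S, blaschkeFactor i.point z - f z / c =
        (∏ i ∈ S, blaschkeFactor i.point z) * ((c - g z) / c) := by
      rw [hfg z hz]
      field_simp
    rw [h3, norm_mul, norm_div, hcn, div_one]
    calc _ ≤ ‖c - g z‖ := mul_le_of_le_one_left (norm_nonneg _)
            (norm_prod_blaschkeFactor_le_one h0 S hzn.le)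
      _ = ‖(g z - g 0) + (g 0 - c)‖ := by rw [norm_sub_rev]; congr 1; ring
      _ ≤ _ := (norm_add_le _ _).trans (add_le_add h1 h2)
  have hpos : 0 < 2 / (1 - ‖z‖) + 1 := by
    have := sub_pos.2 hzn
    positivity
  unfold HasProd
  rw [SummationFilter.unconditional_filter, Metric.tendsto_nhds]
  intro δ hδ
  have := key (δ / 2 / (2 / (1 - ‖z‖) + 1)) (by positivity)
  filter_upwards [this] with S hS
  rw [dist_eq_norm]
  refine hS.trans_lt ?_
  calc _ = δ / 2 / (2 / (1 - ‖z‖) + 1) * (2 / (1 - ‖z‖) + 1) := by ring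
    _ = δ / 2 := div_mul_cancel₀ _ hpos.ne'
    _ < δ := half_lt_self hδ

namespace IsInner

variable {φ : ℂ → ℂ}

lemma tendsto_norm (hφ : IsInner φ) {r : ℕ → ℝ} (hr : Tendsto r atTop (𝓝[<] 1)) :
    ∀ᵐ θ ∂(volume.restrict (Ioc (0 : ℝ) (2 * π))),
      Tendsto (fun n => ‖φ (circleMap 0 (r n) θ)‖) atTop (𝓝 1) := by
  filter_upwards [hφ.2.2] with θ ⟨L, hL, hlim⟩
  rw [← hL]
  simpa [circleMap_zero, Function.comp_def] using (hlim.comp hr).norm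

lemma exists_radii : ∃ r : ℕ → ℝ, (∀ n, 0 < r n ∧ r n < 1) ∧ Tendsto r atTop (𝓝[<] 1) := by
  obtain ⟨r, -, hr, hlim⟩ := exists_seq_strictMono_tendsto' (zero_lt_one (α := ℝ))
  exact ⟨r, fun n => ⟨(hr n).1, (hr n).2⟩,
    tendsto_nhdsWithin_iff.2 ⟨hlim, Eventually.of_forall fun n => (hr n).2⟩⟩

/-- Powers of an inner function satisfy the Cauchy estimate coming from its boundary values. -/
lemma norm_pow_le (hφ : IsInner φ) {z : ℂ} (hz : ‖z‖ < 1) (k : ℕ) :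
    ‖φ z‖ ^ k ≤ 2 / (1 - ‖z‖) := by
  obtain ⟨r, hr, hlim⟩ := exists_radii
  obtain ⟨C, hC⟩ := hφ.2.1
  have hd : 0 < 1 - ‖z‖ := sub_pos.2 hz
  have hπ : 0 < 2 * π := by positivity
  have hcont : ∀ n, Continuous fun θ => ‖φ (circleMap 0 (r n) θ)‖ ^ k := fun n =>
    (continuous_comp_circleMap hφ.1.continuousOn (hr n).1.le (hr n).2).norm.pow k
  have hmean : Tendsto (fun n => ∫ θ in Ioc 0 (2 * π), ‖φ (circleMap 0 (r n) θ)‖ ^ k) atTop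
      (𝓝 (∫ _ in Ioc 0 (2 * π), (1 : ℝ))) := by
    refine tendsto_integral_of_dominated_convergence (fun _ => C ^ k)
      (fun n => (hcont n).aestronglyMeasurable) (by simp) (fun n => ?_) ?_
    · refine Eventually.of_forall fun θ => ?_
      rw [Real.norm_of_nonneg (by positivity)]
      exact pow_le_pow_left₀ (norm_nonneg _) (hC _ (circleMap_zero_mem_ball (hr n).1.le (hr n).2 θ)) _
    · filter_upwards [hφ.tendsto_norm hlim] with θ hθ
      simpa using hθ.pow k
  have hone : ∫ _ in Ioc 0 (2 * π), (1 : ℝ) = 2 * π := by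
    simp [Real.pi_pos.le]
  rw [hone] at hmean
  have hlim2 : Tendsto (fun n => (2 * π)⁻¹ * (2 / (1 - ‖z‖) *
      ∫ θ in Ioc 0 (2 * π), ‖φ (circleMap 0 (r n) θ)‖ ^ k)) atTop (𝓝 (2 / (1 - ‖z‖))) := by
    have := (hmean.const_mul (2 / (1 - ‖z‖))).const_mul (2 * π)⁻¹
    rwa [mul_comm (2 / (1 - ‖z‖)), inv_mul_cancel_left₀ hπ.ne'] at this
  refine ge_of_tendsto hlim2 ?_
  have hev : ∀ᶠ n in atTop, (1 + ‖z‖) / 2 < r n :=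
    (tendsto_nhds_of_tendsto_nhdsWithin hlim).eventually_const_lt (by linarith)
  filter_upwards [hev] with n hn
  obtain ⟨hr0, hr1⟩ := hr n
  have habs : |r n| = r n := abs_of_pos hr0
  have hav := DiffContOnCl.circleAverage_smul_div (f := fun w => φ w ^ k) (c := 0) (R := r n)
    (w := z) (by
      refine DifferentiableOn.diffContOnCl (s := ball 0 |r n|) ((hφ.1.pow k).mono ?_)
      rw [habs]
      exact closure_ball_subset_closedBall.trans (closedBall_subset_ball hr1))
    (by rw [habs, mem_ball_zero_iff]; linarith)
  rw [← norm_pow, ← hav, Real.circleAverage_def, norm_smul,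
    intervalIntegral.integral_of_le hπ.le, norm_inv, Real.norm_of_nonneg hπ.le,
    ← integral_const_mul]
  refine mul_le_mul_of_nonneg_left ?_ (by positivity)
  refine norm_integral_le_of_norm_le (((hcont n).const_mul _).integrableOn_Ioc) ?_
  refine Eventually.of_forall fun θ => ?_
  have hn' : ‖circleMap 0 (r n) θ‖ = r n := by simp [habs]
  rw [norm_smul, norm_pow, norm_div, sub_zero, hn']
  refine mul_le_mul_of_nonneg_right ?_ (by positivity)
  have h1 : r n - ‖z‖ ≤ ‖circleMap 0 (r n) θ - z‖ := by
    simpa [habs] using norm_sub_norm_le (circleMap 0 (r n) θ) z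
  rw [div_le_div_iff₀ (by linarith) hd]
  nlinarith

lemma norm_le_one (hφ : IsInner φ) {z : ℂ} (hz : z ∈ ball (0 : ℂ) 1) : ‖φ z‖ ≤ 1 := by
  by_contra! h
  obtain ⟨k, hk⟩ := ((tendsto_pow_atTop_atTop_of_one_lt h).eventually_gt_atTop
    (2 / (1 - ‖z‖))).exists
  exact absurd (hφ.norm_pow_le (by simpa using hz) k) (not_le.2 hk)

end IsInner

/-- Averaging the logarithm of a disc automorphism over its zero, which runs through a circle. -/
lemma lintegral_negLogNorm_discInvolution_le {w : ℂ} {ρ : ℝ} (hw : ‖w‖ < 1) (hρ0 : 0 < ρ)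
    (hρ1 : ρ < 1) :
    ∫⁻ t in Ioc 0 (2 * π), negLogNorm (discInvolution (circleMap 0 ρ t) w) ≤
      ENNReal.ofReal (2 * π * -(Real.log ρ + Real.posLog (ρ⁻¹ * ‖w‖))) := by
  set G : ℂ → ℝ := fun a => Real.log ‖a - w‖ - Real.log ‖1 - (starRingEnd ℂ) w * a‖ with hG
  have hne : ∀ u ∈ closedBall (0 : ℂ) |ρ|, 1 - (starRingEnd ℂ) w * u ≠ 0 := fun u hu =>
    one_sub_conj_mul_ne_zero hw (by
      rw [abs_of_pos hρ0, mem_closedBall_zero_iff] at hu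
      linarith)
  have han : AnalyticOnNhd ℂ (fun a => 1 - (starRingEnd ℂ) w * a) (closedBall 0 |ρ|) :=
    fun _ _ => by fun_prop
  have hi1 : CircleIntegrable (fun a => Real.log ‖a - w‖) 0 ρ :=
    circleIntegrable_log_norm_sub_const ρ
  have hi2 : CircleIntegrable (fun a => Real.log ‖1 - (starRingEnd ℂ) w * a‖) 0 ρ :=
    MeromorphicOn.circleIntegrable_log_norm
      fun u hu => (han u (sphere_subset_closedBall hu)).meromorphicAt
  have hav : Real.circleAverage G 0 ρ = Real.log ρ + Real.posLog (ρ⁻¹ * ‖w‖) := by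
    have h1 := han.circleAverage_log_norm_of_ne_zero hne
    have h2 := circleAverage_log_norm_sub_const_eq_log_radius_add_posLog (a := w) (c := 0) hρ0.ne'
    rw [hG, Real.circleAverage_fun_sub hi1 hi2, h1, h2]
    simp
  have hGint : IntegrableOn (fun t => -G (circleMap 0 ρ t)) (Ioc 0 (2 * π)) := by
    have : CircleIntegrable G 0 ρ := hi1.sub hi2
    exact ((intervalIntegrable_iff_integrableOn_Ioc_of_le (by positivity)).1 this).neg
  have hval : ∀ t, circleMap 0 ρ t ≠ w →
      negLogNorm (discInvolution (circleMap 0 ρ t) w) = ENNReal.ofReal (-G (circleMap 0 ρ t)) ∧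
        0 ≤ -G (circleMap 0 ρ t) := by
    intro t ht
    have hn : ‖circleMap 0 ρ t‖ < 1 := by simpa [abs_of_pos hρ0] using hρ1
    have h1 : circleMap 0 ρ t - w ≠ 0 := sub_ne_zero.2 ht
    have h2 := one_sub_conj_mul_ne_zero hn hw.le
    have h3 : ‖1 - (starRingEnd ℂ) (circleMap 0 ρ t) * w‖ =
        ‖1 - (starRingEnd ℂ) w * circleMap 0 ρ t‖ := by
      rw [← RCLike.norm_conj]
      simp [mul_comm]
    have h4 : G (circleMap 0 ρ t) = Real.log ‖discInvolution (circleMap 0 ρ t) w‖ := by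
      rw [discInvolution, norm_div, Real.log_div (norm_ne_zero_iff.2 h1) (norm_ne_zero_iff.2 h2),
        h3]
    rw [h4]
    refine ⟨?_, neg_nonneg.2 (Real.log_nonpos (norm_nonneg _)
      (norm_discInvolution_le_one hn.le hw.le))⟩
    rw [negLogNorm, if_neg]
    exact div_ne_zero h1 h2
  have hae : ∀ᵐ t ∂(volume.restrict (Ioc 0 (2 * π))), circleMap 0 ρ t ≠ w := by
    refine ae_restrict_of_ae ?_
    have := ((countable_singleton w).preimage_circleMap 0 hρ0.ne').measure_zero volume
    exact measure_eq_zero_iff_ae_notMem.1 this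
  rw [lintegral_congr_ae (hae.mono fun t ht => (hval t ht).1),
    ← ofReal_integral_eq_lintegral_ofReal hGint (hae.mono fun t ht => (hval t ht).2)]
  refine ENNReal.ofReal_le_ofReal (le_of_eq ?_)
  rw [integral_neg, ← hav, Real.circleAverage_def, intervalIntegral.integral_of_le (by positivity),
    smul_eq_mul, mul_neg, mul_inv_cancel_left₀ (by positivity)]

/-- On each small circle there is a Frostman shift with small logarithmic means. -/
lemma IsInner.exists_lintegral_negLogNorm_le {φ : ℂ → ℂ} (hφ : IsInner φ)
    (hlt : ∀ z ∈ ball (0 : ℂ) 1, ‖φ z‖ < 1) {ρ : ℝ} (hρ0 : 0 < ρ) (hρ1 : ρ < 1) :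
    ∃ a : ℂ, ‖a‖ = ρ ∧ ∀ ε : ℝ, 0 < ε → ∃ r : ℝ, 0 < r ∧ r < 1 ∧
      ∫⁻ θ in Ioc 0 (2 * π), negLogNorm (discInvolution a (φ (circleMap 0 r θ))) ≤
        ENNReal.ofReal (2 * π * ε) := by
  obtain ⟨r, hr, hlim⟩ := exists_radii
  have hcont : ∀ n, Continuous fun θ => φ (circleMap 0 (r n) θ) := fun n =>
    continuous_comp_circleMap hφ.1.continuousOn (hr n).1.le (hr n).2
  have hball : ∀ n θ, ‖φ (circleMap 0 (r n) θ)‖ < 1 := fun n θ =>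
    hlt _ (circleMap_zero_mem_ball (hr n).1.le (hr n).2 θ)
  set μ : Measure ℝ := volume.restrict (Ioc 0 (2 * π)) with hμ
  set F : ℕ → ℝ → ℝ → ENNReal := fun n t θ =>
    negLogNorm (discInvolution (circleMap 0 ρ t) (φ (circleMap 0 (r n) θ))) with hF
  set L : ℝ → ℝ := fun x => 2 * π * -(Real.log ρ + Real.posLog (ρ⁻¹ * x)) with hL
  have hLc : Continuous L := by
    rw [hL]
    fun_prop
  have hL1 : L 1 = 0 := by
    have : Real.posLog ρ⁻¹ = Real.log ρ⁻¹ := by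
      refine Real.posLog_eq_log ?_
      rw [abs_of_pos (inv_pos.2 hρ0)]
      exact (one_le_inv₀ hρ0).2 hρ1.le
    simp [hL, this]
  have hLle : ∀ x, L x ≤ 2 * π * -Real.log ρ := fun x => by
    have := Real.posLog_nonneg (x := ρ⁻¹ * x)
    exact mul_le_mul_of_nonneg_left (by linarith) (by positivity)
  have hmeas : ∀ n, Measurable (Function.uncurry (F n)) := by
    intro n
    refine measurable_negLogNorm.comp ?_
    have h1 : Measurable fun p : ℝ × ℝ => φ (circleMap 0 (r n) p.2) :=
      ((hcont n).comp continuous_snd).measurable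
    have h2 : Measurable fun p : ℝ × ℝ => circleMap 0 ρ p.1 :=
      ((continuous_circleMap 0 ρ).comp continuous_fst).measurable
    have h3 : Measurable fun p : ℝ × ℝ => (starRingEnd ℂ) (circleMap 0 ρ p.1) :=
      Complex.continuous_conj.measurable.comp h2
    exact (h2.sub h1).div (measurable_const.sub (h3.mul h1))
  have hlimL : Tendsto (fun n => ∫⁻ θ, ENNReal.ofReal (L ‖φ (circleMap 0 (r n) θ)‖) ∂μ) atTop
      (𝓝 0) := by
    have := tendsto_lintegral_of_dominated_convergence (μ := μ)
      (F := fun n θ => ENNReal.ofReal (L ‖φ (circleMap 0 (r n) θ)‖)) (f := fun _ => 0)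
      (fun _ => ENNReal.ofReal (2 * π * -Real.log ρ))
      (fun n => ENNReal.measurable_ofReal.comp (hLc.comp (hcont n).norm).measurable)
      (fun n => Eventually.of_forall fun θ => ENNReal.ofReal_le_ofReal (hLle _))
      (by
        rw [lintegral_const]
        exact ENNReal.mul_ne_top ENNReal.ofReal_ne_top (measure_ne_top _ _))
      (by
        filter_upwards [hφ.tendsto_norm hlim] with θ hθ
        have h := ENNReal.tendsto_ofReal ((hLc.tendsto 1).comp hθ)
        rwa [hL1, ENNReal.ofReal_zero] at h)
    simpa using this
  have hdouble : Tendsto (fun n => ∫⁻ t, ∫⁻ θ, F n t θ ∂μ ∂μ) atTop (𝓝 0) := by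
    refine tendsto_of_tendsto_of_tendsto_of_le_of_le tendsto_const_nhds hlimL
      (fun _ => zero_le) fun n => ?_
    dsimp only
    rw [lintegral_lintegral_swap (hmeas n).aemeasurable]
    exact lintegral_mono fun θ =>
      lintegral_negLogNorm_discInvolution_le (hball n θ) hρ0 hρ1
  have hmeas' : ∀ n, Measurable fun t => ∫⁻ θ, F n t θ ∂μ := fun n =>
    (hmeas n).lintegral_prod_right'
  have hzero : ∫⁻ t, liminf (fun n => ∫⁻ θ, F n t θ ∂μ) atTop ∂μ = 0 := by
    refine le_antisymm ((lintegral_liminf_le hmeas').trans ?_) zero_le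
    rw [hdouble.liminf_eq]
  rw [lintegral_eq_zero_iff (Measurable.liminf hmeas')] at hzero
  have hneBot : NeBot (ae μ) := by
    rw [ae_neBot, hμ, Ne, Measure.restrict_eq_zero]
    simp [Real.pi_pos]
  obtain ⟨t, ht⟩ := hzero.exists
  refine ⟨circleMap 0 ρ t, by simp [abs_of_pos hρ0], fun ε hε => ?_⟩
  have hlt' : liminf (fun n => ∫⁻ θ, F n t θ ∂μ) atTop < ENNReal.ofReal (2 * π * ε) := by
    have ht' : liminf (fun n => ∫⁻ θ, F n t θ ∂μ) atTop = 0 := ht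
    rw [ht']
    simpa using by positivity
  obtain ⟨n, hn⟩ := (frequently_lt_of_liminf_lt (by isBoundedDefault) hlt').exists
  exact ⟨r n, (hr n).1, (hr n).2, hn.le⟩

lemma isBlaschkeProductOn_of_eq_const {φ : ℂ → ℂ} {c : ℂ} {s : Set ℂ} (hc : ‖c‖ = 1)
    (h : ∀ z ∈ s, φ z = c) : IsBlaschkeProductOn φ s :=
  ⟨0, c, Empty, inferInstance, Empty.elim, hc, fun i => i.elim, summable_empty,
    fun z hz => by simp [blaschkeProd, h z hz]⟩

lemma norm_sub_neg_discInvolution_le {a w : ℂ} (ha : ‖a‖ ≤ 1 / 2) (hw : ‖w‖ ≤ 1) :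
    ‖w - -discInvolution a w‖ ≤ 4 * ‖a‖ := by
  have hne := one_sub_conj_mul_ne_zero (lt_of_le_of_lt ha one_half_lt_one) hw
  have h1 : w - -discInvolution a w =
      (a - (starRingEnd ℂ) a * w ^ 2) / (1 - (starRingEnd ℂ) a * w) := by
    rw [discInvolution, eq_div_iff hne, sub_neg_eq_add, add_mul, div_mul_cancel₀ _ hne]
    ring
  have h2 : 1 / 2 ≤ ‖1 - (starRingEnd ℂ) a * w‖ := by
    have := norm_sub_norm_le 1 ((starRingEnd ℂ) a * w)
    rw [norm_mul, RCLike.norm_conj, norm_one] at this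
    nlinarith [norm_nonneg a, norm_nonneg w]
  have h3 : ‖a - (starRingEnd ℂ) a * w ^ 2‖ ≤ 2 * ‖a‖ := by
    refine (norm_sub_le _ _).trans ?_
    rw [norm_mul, RCLike.norm_conj, norm_pow]
    have : ‖a‖ * ‖w‖ ^ 2 ≤ ‖a‖ :=
      mul_le_of_le_one_right (norm_nonneg _) (pow_le_one₀ (norm_nonneg _) hw)
    linarith
  rw [h1, norm_div, div_le_iff₀ (norm_pos_iff.2 hne)]
  nlinarith [norm_nonneg a]

lemma negLogNorm_neg (w : ℂ) : negLogNorm (-w) = negLogNorm w := by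
  simp [negLogNorm]

/-- Inner functions are uniform limits of Blaschke products. -/
lemma IsInner.exists_isBlaschkeProductOn_norm_sub_lt {φ : ℂ → ℂ} (hφ : IsInner φ) {ε : ℝ}
    (hε : 0 < ε) : ∃ B : ℂ → ℂ, IsBlaschkeProductOn B (ball (0 : ℂ) 1) ∧
      ∀ z ∈ ball (0 : ℂ) 1, ‖φ z - B z‖ < ε := by
  by_cases hconst : ∃ c ∈ ball (0 : ℂ) 1, ‖φ c‖ = 1
  · obtain ⟨c, hc, h1⟩ := hconst
    exact ⟨φ, isBlaschkeProductOn_of_eq_const h1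
      (eqOn_const_of_norm_eq_one hφ.1 (fun w hw => hφ.norm_le_one hw) hc h1),
      fun z _ => by simpa using hε⟩
  have hlt : ∀ z ∈ ball (0 : ℂ) 1, ‖φ z‖ < 1 := fun z hz =>
    lt_of_le_of_ne (hφ.norm_le_one hz) fun h => hconst ⟨z, hz, h⟩
  obtain ⟨ρ, hρ0, hρ1, hρε, hρne⟩ : ∃ ρ : ℝ, 0 < ρ ∧ ρ ≤ 1 / 2 ∧ 4 * ρ < ε ∧ ρ ≠ ‖φ 0‖ := by
    have hpos : 0 < min (1 / 2) (ε / 4) := lt_min one_half_pos (by positivity)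
    obtain ⟨ρ, hρ, hne⟩ := ((Ioo_infinite hpos).sdiff (finite_singleton ‖φ 0‖)).nonempty
    have h1 := hρ.2.trans_le (min_le_left _ _)
    have h2 := hρ.2.trans_le (min_le_right _ _)
    exact ⟨ρ, hρ.1, h1.le, by linarith, hne⟩
  obtain ⟨a, ha, hsmall⟩ := hφ.exists_lintegral_negLogNorm_le hlt hρ0
    (hρ1.trans_lt one_half_lt_one)
  have ha1 : ‖a‖ < 1 := by
    rw [ha]
    exact hρ1.trans_lt one_half_lt_one
  refine ⟨fun z => -discInvolution a (φ z),
    isBlaschkeProductOn_of_lintegral_negLogNorm_le ?_ (fun w hw => ?_) ?_ ?_, fun z hz => ?_⟩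
  · exact ((differentiableOn_discInvolution ha1).comp hφ.1
      fun w hw => by simpa using hφ.norm_le_one hw).neg
  · rw [norm_neg]
    exact norm_discInvolution_le_one ha1.le (hφ.norm_le_one hw)
  · refine neg_ne_zero.2 (div_ne_zero (sub_ne_zero.2 ?_) ?_)
    · rintro rfl
      exact hρne ha.symm
    · exact one_sub_conj_mul_ne_zero ha1 (hφ.norm_le_one (by simp))
  · simpa only [negLogNorm_neg] using hsmall
  · refine (norm_sub_neg_discInvolution_le (by rwa [ha]) (hφ.norm_le_one hz)).trans_lt ?_
    rwa [ha]

/-- A uniform limit of functions having limits along a filter has such a limit too. -/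
lemma exists_tendsto_of_tendstoUniformlyOnFilter {α : Type*} {F : ℕ → α → ℂ} {f : α → ℂ}
    {l : Filter α} [NeBot l] {L : ℕ → ℂ} (h : TendstoUniformlyOnFilter F f atTop l)
    (hL : ∀ n, Tendsto (F n) l (𝓝 (L n))) : ∃ ℓ, Tendsto L atTop (𝓝 ℓ) ∧ Tendsto f l (𝓝 ℓ) := by
  have hc : CauchySeq L := by
    rw [Metric.cauchySeq_iff]
    intro ε hε
    have h1 := (Metric.tendstoUniformlyOnFilter_iff.1 h (ε / 3) (by positivity)).curry
    obtain ⟨N, hN⟩ := eventually_atTop.1 h1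
    refine ⟨N, fun m hm n hn => ?_⟩
    have h2 : dist (L m) (L n) ≤ ε / 3 + ε / 3 := by
      refine le_of_tendsto ((hL m).dist (hL n)) ?_
      filter_upwards [hN m hm, hN n hn] with x hx hy
      exact (dist_triangle_left _ _ (f x)).trans (add_le_add hx.le hy.le)
    linarith
  obtain ⟨ℓ, hℓ⟩ := cauchySeq_tendsto_of_complete hc
  exact ⟨ℓ, hℓ, h.tendsto_of_eventually_tendsto (Eventually.of_forall hL) hℓ⟩

lemma tendsto_radius_mul_exp (θ : ℝ) :
    Tendsto (fun r : ℝ => (r : ℂ) * Complex.exp ((θ : ℂ) * Complex.I)) (𝓝[<] 1)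
      (𝓟 (ball (0 : ℂ) 1)) := by
  rw [tendsto_principal]
  filter_upwards [Ioo_mem_nhdsLT zero_lt_one] with r hr
  simpa [Complex.norm_exp_ofReal_mul_I, abs_of_pos hr.1] using hr.2

/-- Uniform limits of inner functions are inner. -/
lemma IsInner.of_tendstoUniformlyOn {g : ℂ → ℂ} {ψ : ℕ → ℂ → ℂ} (hψ : ∀ n, IsInner (ψ n))
    (h : TendstoUniformlyOn ψ g atTop (ball (0 : ℂ) 1)) : IsInner g := by
  refine ⟨h.tendstoLocallyUniformlyOn.differentiableOn (Eventually.of_forall fun n => (hψ n).1)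
    isOpen_ball, ?_, ?_⟩
  · obtain ⟨N, hN⟩ := (Metric.tendstoUniformlyOn_iff.1 h 1 one_pos).exists
    refine ⟨2, fun z hz => ?_⟩
    have h1 := (hψ N).norm_le_one hz
    have h2 := hN z hz
    rw [dist_eq_norm] at h2
    have h3 := norm_sub_norm_le (g z) (ψ N z)
    linarith
  · filter_upwards [ae_all_iff.2 fun n => (hψ n).2.2] with θ hθ
    choose L hL1 hL using hθ
    have hu : TendstoUniformlyOnFilter
        (fun n (r : ℝ) => ψ n ((r : ℂ) * Complex.exp ((θ : ℂ) * Complex.I)))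
        (fun r : ℝ => g ((r : ℂ) * Complex.exp ((θ : ℂ) * Complex.I))) atTop (𝓝[<] (1 : ℝ)) := by
      intro u hu
      exact (tendsto_id.prodMap (tendsto_radius_mul_exp θ)).eventually
        (tendstoUniformlyOn_iff_tendstoUniformlyOnFilter.1 h u hu)
    obtain ⟨ℓ, hℓ, hg⟩ := exists_tendsto_of_tendstoUniformlyOnFilter hu hL
    refine ⟨ℓ, tendsto_nhds_unique hℓ.norm ?_, hg⟩
    simp [hL1]

/-- **Frostman's approximation theorem.** Every inner function can be uniformly approximated on
the open unit disc by Blaschke products; consequently the Blaschke products are uniformly dense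
in the inner functions, and the set of inner functions is closed under uniform convergence on
the disc. -/
theorem frostman_approximation (φ : ℂ → ℂ) (hφ : IsInner φ) (ε : ℝ) (hε : 0 < ε) :
    (∃ B : ℂ → ℂ, IsBlaschkeProductOn B (ball (0:ℂ) 1) ∧
      ∀ z ∈ ball (0:ℂ) 1, ‖φ z - B z‖ < ε) ∧
    (∀ (g : ℂ → ℂ) (ψ : ℕ → ℂ → ℂ), (∀ n, IsInner (ψ n)) →
      TendstoUniformlyOn ψ g atTop (ball (0:ℂ) 1) → IsInner g) := by
  exact ⟨hφ.exists_isBlaschkeProductOn_norm_sub_lt hε,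
    fun _ _ hψ h => IsInner.of_tendstoUniformlyOn hψ h⟩
end

section
/- (Adamjan–Arov–Krein) Let f ∈ L^∞(𝕋) be such that dist(f, H^∞(𝕋)) < 1. Then there exists ω ∈ f + H^∞(𝕋) such that |ω(e^{iθ})| = 1 for almost every e^{iθ} ∈ 𝕋. -/
open Complex MeasureTheory AddCircle
open scoped Real

instance : Fact (0 < 2 * Real.pi) := ⟨by positivity⟩

/-- `H^∞(𝕋)`: the elements of `L^∞` of the circle whose negative Fourier coefficients all
vanish. -/
noncomputable def Hinf : Set (Lp ℂ ⊤ (haarAddCircle : Measure (AddCircle (2*π)))) :=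
  {g | ∀ n : ℤ, n < 0 → fourierCoeff (⇑g) n = 0}

/-- Hahn–Banach: a functional dominated by `‖T v‖` factors through a functional of norm at most
one on the codomain of `T`. -/
theorem exists_dual_comp_eq_of_norm_le {V E : Type*} [AddCommGroup V] [Module ℂ V]
    [NormedAddCommGroup E] [NormedSpace ℂ E] (T : V →ₗ[ℂ] E) (ψ : V →ₗ[ℂ] ℂ)
    (h : ∀ v, ‖ψ v‖ ≤ ‖T v‖) : ∃ Λ : StrongDual ℂ E, ‖Λ‖ ≤ 1 ∧ ∀ v, Λ (T v) = ψ v := by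
  have hψ : ψ ∈ LinearMap.range T.dualMap := by
    rw [LinearMap.range_dualMap_eq_dualAnnihilator_ker, Submodule.mem_dualAnnihilator]
    intro v hv
    simpa [LinearMap.mem_ker.1 hv] using h v
  obtain ⟨φ, rfl⟩ := hψ
  let φ₀ : StrongDual ℂ (LinearMap.range T) :=
    (φ.comp (LinearMap.range T).subtype).mkContinuous 1 (by
      rintro ⟨_, v, rfl⟩
      simpa using h v)
  obtain ⟨Λ, hΛ, hn⟩ := exists_extension_norm_eq (LinearMap.range T) φ₀
  refine ⟨Λ, hn.trans_le (LinearMap.mkContinuous_norm_le _ zero_le_one _), fun v => ?_⟩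
  exact hΛ ⟨T v, v, rfl⟩

/-- If `‖ψ‖ ≤ δ < 1` and `‖e‖ ≤ 1` with respect to a seminorm `N`, there is an extremal `c` such that
`ψ + c • e` has norm one and is nearly attained only at vectors on which `e` is not small. -/
theorem exists_extremal_perturbation {V : Type*} [AddCommGroup V] [Module ℂ V]
    (N : Seminorm ℂ V) (ψ e : V →ₗ[ℂ] ℂ) {δ : ℝ} (hδ : δ < 1) (hψ : ∀ v, ‖ψ v‖ ≤ δ * N v)
    (he : ∀ v, ‖e v‖ ≤ N v) (v₀ : V) (hv₀ : e v₀ ≠ 0) :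
    ∃ c : ℂ, (∀ v, ‖ψ v + c * e v‖ ≤ N v) ∧ ∃ r > 0, ∀ η < 1, ∃ v, N v ≤ 1 ∧
      r ≤ ‖e v‖ ∧ η < ‖ψ v + c * e v‖ := by
  let S : Set ℂ := {c | ∀ v, ‖ψ v + c * e v‖ ≤ N v}
  have hS0 : (0 : ℂ) ∈ S := fun v => by
    have := apply_nonneg N v
    simpa using (hψ v).trans (by nlinarith)
  have hSc : IsClosed S := by
    simp only [S, Set.ofPred_forall]
    exact isClosed_iInter fun v => isClosed_le (by fun_prop) continuous_const
  have hSb : Bornology.IsBounded S := by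
    refine (Metric.isBounded_closedBall (x := (0 : ℂ)) (r := 2 * N v₀ / ‖e v₀‖)).subset
      fun c hc => ?_
    rw [mem_closedBall_zero_iff, le_div_iff₀ (norm_pos_iff.2 hv₀), ← norm_mul]
    have h1 := hc v₀
    have h2 := hS0 v₀
    have h3 := norm_sub_le (ψ v₀ + c * e v₀) (ψ v₀)
    simp only [zero_mul, add_zero] at h2
    rw [add_sub_cancel_left] at h3
    linarith
  obtain ⟨c, hc, hmax⟩ := (Metric.isCompact_of_isClosed_isBounded hSc hSb).exists_isMaxOn ⟨0, hS0⟩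
    Complex.continuous_re.continuousOn
  refine ⟨c, hc, (1 - δ) / (2 * (‖c‖ + 1)), by have := sub_pos.2 hδ; positivity, fun η hη => ?_⟩
  obtain ⟨ζ, hζ, hζ1⟩ : ∃ ζ : ℝ, max (max η ((1 + δ) / 2)) 0 < ζ ∧ ζ < 1 :=
    exists_between (max_lt (max_lt hη (by linarith)) zero_lt_one)
  simp only [max_lt_iff] at hζ
  obtain ⟨w, hw⟩ : ∃ w, ζ * N w < ‖ψ w + c * e w‖ := by
    by_contra! H
    have : c + ((1 - ζ : ℝ) : ℂ) ∈ S := fun v => by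
      have h1 := norm_add_le (ψ v + c * e v) (((1 - ζ : ℝ) : ℂ) * e v)
      rw [norm_mul, norm_real, Real.norm_of_nonneg (by linarith)] at h1
      rw [add_mul, ← add_assoc]
      nlinarith [H v, he v]
    have := hmax this
    simp at this
    linarith
  have hN : 0 < N w := by
    have := hc w
    by_contra! h
    nlinarith
  have hsc : ψ (((N w)⁻¹ : ℂ) • w) + c * e (((N w)⁻¹ : ℂ) • w)
      = ((N w)⁻¹ : ℂ) * (ψ w + c * e w) := by simp; ring
  have hη' : ζ < ‖ψ (((N w)⁻¹ : ℂ) • w) + c * e (((N w)⁻¹ : ℂ) • w)‖ := by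
    rw [hsc, norm_mul, norm_inv, norm_real, Real.norm_of_nonneg hN.le, inv_mul_eq_div,
      lt_div_iff₀ hN]
    exact hw
  have hNw : N (((N w)⁻¹ : ℂ) • w) = 1 := by
    rw [map_smul_eq_mul, norm_inv, norm_real, Real.norm_of_nonneg hN.le, inv_mul_cancel₀ hN.ne']
  refine ⟨((N w)⁻¹ : ℂ) • w, hNw.le, ?_, by linarith⟩
  generalize ((N w)⁻¹ : ℂ) • w = u at *
  have h1 := norm_add_le (ψ u) (c * e u)
  have h2 := hψ u
  rw [norm_mul] at h1
  rw [div_le_iff₀ (by positivity)]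
  nlinarith [norm_nonneg (e u)]

/-- Functionals of norm at most one on `L¹` of a probability space are represented on `L²` by
functions bounded by one. -/
theorem exists_ae_norm_le_one_repr {α : Type*} [MeasurableSpace α] {μ : Measure α}
    [IsProbabilityMeasure μ] (Λ : StrongDual ℂ (Lp ℂ 1 μ)) (hΛ : ‖Λ‖ ≤ 1) :
    ∃ k : α → ℂ, AEStronglyMeasurable k μ ∧ (∀ᵐ x ∂μ, ‖k x‖ ≤ 1) ∧
      ∀ (v : α → ℂ) (hv : MemLp v 2 μ),
        Λ ((hv.mono_exponent one_le_two).toLp v) = ∫ x, k x * v x ∂μ := by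
  let J : Lp ℂ 2 μ →ₗ[ℂ] Lp ℂ 1 μ :=
    { toFun v := ((Lp.memLp v).mono_exponent one_le_two).toLp v
      map_add' u v := by
        rw [← MemLp.toLp_add]
        exact MemLp.toLp_congr _ _ (Lp.coeFn_add u v)
      map_smul' c v := by
        rw [RingHom.id_apply, ← MemLp.toLp_const_smul]
        exact MemLp.toLp_congr _ _ (Lp.coeFn_smul c v) }
  have hJ (v : Lp ℂ 2 μ) : ‖J v‖ ≤ 1 * ‖v‖ := by
    rw [one_mul, LinearMap.coe_mk, AddHom.coe_mk, Lp.norm_toLp, Lp.norm_def]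
    exact ENNReal.toReal_mono (Lp.eLpNorm_ne_top v)
      (eLpNorm_le_eLpNorm_of_exponent_le one_le_two (Lp.aestronglyMeasurable v))
  let κ := (InnerProductSpace.toDual ℂ (Lp ℂ 2 μ)).symm (Λ.comp (J.mkContinuous 1 hJ))
  have hκ (v : α → ℂ) (hv : MemLp v 2 μ) :
      Λ ((hv.mono_exponent one_le_two).toLp v) = ∫ x, (starRingEnd ℂ) (κ x) * v x ∂μ := by
    have h1 : inner ℂ κ (hv.toLp v) = Λ (J (hv.toLp v)) :=
      InnerProductSpace.toDual_symm_apply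
    have h2 : J (hv.toLp v) = (hv.mono_exponent one_le_two).toLp v :=
      MemLp.toLp_congr ((Lp.memLp _).mono_exponent one_le_two) _ hv.coeFn_toLp
    rw [← h2, ← h1, L2.inner_def]
    refine integral_congr_ae ?_
    filter_upwards [hv.coeFn_toLp] with x hx
    rw [hx, RCLike.inner_apply, mul_comm]
  have hκm : StronglyMeasurable κ := Lp.stronglyMeasurable κ
  refine ⟨fun x => (starRingEnd ℂ) (κ x), ?_, ?_, hκ⟩
  · exact (Complex.continuous_conj.comp_stronglyMeasurable hκm).aestronglyMeasurable
  simp only [RCLike.norm_conj]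
  refine ae_le_of_forall_setIntegral_le (f := fun x => ‖κ x‖) (g := fun _ => 1)
    (((Lp.memLp κ).integrable one_le_two).norm) (integrable_const _) fun s hs _ => ?_
  let v : α → ℂ := s.indicator fun x => κ x / (‖κ x‖ : ℂ)
  have hvm : Measurable v :=
    (hκm.measurable.div (Complex.measurable_ofReal.comp hκm.measurable.norm)).indicator hs
  have hvb (x : α) : ‖v x‖ ≤ s.indicator (fun _ => (1 : ℝ)) x := by
    by_cases hx : x ∈ s
    · simp [v, hx, div_self_le_one]
    · simp [v, hx]
  have hv1 (x : α) : ‖v x‖ ≤ 1 := (hvb x).trans (Set.indicator_le_self' (by simp) x)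
  have hv (p) : MemLp v p μ := MemLp.of_bound hvm.aestronglyMeasurable 1 (.of_forall hv1)
  have h1 := Λ.le_of_opNorm_le hΛ (((hv 2).mono_exponent one_le_two).toLp v)
  rw [hκ v (hv 2), one_mul, Lp.norm_toLp, eLpNorm_one_eq_lintegral_enorm,
    ← integral_norm_eq_lintegral_enorm hvm.aestronglyMeasurable] at h1
  have h2 : ∫ x, (starRingEnd ℂ) (κ x) * v x ∂μ = ((∫ x in s, ‖κ x‖ ∂μ : ℝ) : ℂ) := by
    rw [← integral_complex_ofReal, ← integral_indicator hs]
    refine integral_congr_ae (.of_forall fun x => ?_)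
    by_cases hx : x ∈ s
    · by_cases h0 : κ x = 0
      · simp [v, hx, h0]
      · have : (‖κ x‖ : ℂ) ≠ 0 := by simpa using h0
        simp only [v, hx, Set.indicator_of_mem]
        rw [mul_div_assoc', mul_comm, Complex.mul_conj', pow_two, mul_div_assoc, div_self this,
          mul_one]
    · simp [v, hx]
  rw [h2, norm_real] at h1
  calc _ ≤ _ := Real.le_norm_self _
    _ ≤ _ := h1
    _ ≤ ∫ x, s.indicator (fun _ => (1 : ℝ)) x ∂μ :=
      integral_mono (hv 1 |>.integrable le_rfl).norm
        ((integrable_const _).indicator hs) hvb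
    _ = _ := integral_indicator hs

open Polynomial in
theorem toAddCircle_apply_eq_eval (p : ℂ[X]) (x : AddCircle (2 * π)) :
    p.toAddCircle x = p.eval (x.toCircle : ℂ) := by
  induction p using Polynomial.induction_on' with
  | add p q hp hq => simp [hp, hq]
  | monomial n a => simp [toAddCircle_monomial_eq_smul_fourier, AddCircle.toCircle_nsmul]

open Polynomial in
/-- Jensen's inequality for polynomials on the unit circle. -/
theorem log_norm_coeff_zero_le_integral (p : ℂ[X]) (hp : p.coeff 0 ≠ 0) :
    Integrable (fun x => Real.log ‖p.toAddCircle x‖) (haarAddCircle (T := 2 * π)) ∧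
      (∀ᵐ x ∂(haarAddCircle (T := 2 * π)), p.toAddCircle x ≠ 0) ∧
      Real.log ‖p.coeff 0‖ ≤
        ∫ x, Real.log ‖p.toAddCircle x‖ ∂(haarAddCircle (T := 2 * π)) := by
  have hp0 : p ≠ 0 := by rintro rfl; simp at hp
  have htwo : ENNReal.ofReal (2 * π) ≠ 0 := by simp [Real.pi_pos]
  have hcirc (x : ℝ) : p.toAddCircle (x : AddCircle (2 * π)) = p.eval (circleMap 0 1 x) := by
    rw [toAddCircle_apply_eq_eval]
    simp [toCircle, circleMap]
  have hmeas : Measurable fun x : AddCircle (2 * π) => Real.log ‖p.toAddCircle x‖ :=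
    Real.measurable_log.comp p.toAddCircle.continuous.measurable.norm
  refine ⟨?_, ?_, ?_⟩
  · have h1 := p.intervalIntegrable_mahlerMeasure
    rw [intervalIntegrable_iff_integrableOn_Ioc_of_le Real.two_pi_pos.le] at h1
    have h2 := (AddCircle.measurePreserving_mk (2 * π) 0).integrable_comp
      hmeas.aestronglyMeasurable
    simp only [Function.comp_def, hcirc, zero_add] at h2
    have h3 := h2.1 h1
    rwa [volume_eq_smul_haarAddCircle, integrable_smul_measure htwo ENNReal.ofReal_ne_top] at h3
  · have hfin : {x : AddCircle (2 * π) | p.toAddCircle x = 0}.Finite := by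
      refine Set.Finite.of_finite_image (f := fun x => (x.toCircle : ℂ))
        (p.roots.finite_toSet.subset ?_)
        ((Subtype.val_injective.comp (AddCircle.injective_toCircle Real.two_pi_pos.ne')).injOn)
      rintro _ ⟨x, hx, rfl⟩
      rw [Set.mem_ofPred_eq, toAddCircle_apply_eq_eval] at hx
      simpa [hp0] using hx
    have : NullSingletonClass (volume : Measure (AddCircle (2 * π))) := ⟨fun x => by
      have h := AddCircle.volume_closedBall (T := 2 * π) (x := x) 0
      rw [Metric.closedBall_zero] at h
      simp [h, Real.pi_pos.le]⟩
    have h := hfin.measure_zero (volume : Measure (AddCircle (2 * π)))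
    rw [volume_eq_smul_haarAddCircle, Measure.smul_apply, smul_eq_mul, mul_eq_zero] at h
    simpa [ae_iff] using h.resolve_left htwo
  · have h1 := norm_coeff_le_choose_mul_mahlerMeasure 0 p
    simp only [Nat.choose_zero_right, Nat.cast_one, one_mul] at h1
    have h2 := Real.log_le_log (norm_pos_iff.2 hp) h1
    rw [mahlerMeasure_def_of_ne_zero hp0, Real.log_exp] at h2
    rw [integral_haarAddCircle, ← AddCircle.intervalIntegral_preimage (2 * π) 0]
    simpa [hcirc] using h2

open Polynomial in
/-- A weighted form of Jensen's inequality. -/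
theorem log_norm_coeff_zero_add_integral_mul_log_le (p : ℂ[X]) (hp : p.coeff 0 ≠ 0)
    {w : AddCircle (2 * π) → ℝ} (hwm : AEStronglyMeasurable w haarAddCircle)
    (hw0 : ∀ᵐ x ∂haarAddCircle, 0 ≤ w x) (hw1 : ∀ᵐ x ∂haarAddCircle, w x ≤ 1)
    {A : ℝ} (hA : 0 ≤ A) :
    Real.log ‖p.coeff 0‖ + (∫ x, w x ∂haarAddCircle) * Real.log (1 + A) ≤
      (∫ x, ‖p.toAddCircle x‖ ∂haarAddCircle) +
        A * (∫ x, ‖p.toAddCircle x‖ * w x ∂haarAddCircle) - 1 := by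
  obtain ⟨hint, hne, hlog⟩ := log_norm_coeff_zero_le_integral p hp
  have hwb : ∀ᵐ x ∂haarAddCircle, ‖w x‖ ≤ 1 := by
    filter_upwards [hw0, hw1] with x h0 h1
    rwa [Real.norm_of_nonneg h0]
  have hwi : Integrable w haarAddCircle := .of_bound hwm 1 hwb
  have hpi : Integrable (fun x => ‖p.toAddCircle x‖) (haarAddCircle (T := 2 * π)) :=
    (toAddCircle.integrable p).norm
  have hpwi : Integrable (fun x => ‖p.toAddCircle x‖ * w x) (haarAddCircle (T := 2 * π)) :=
    hpi.mul_bdd (c := 1) hwm hwb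
  have key : ∫ x, (Real.log ‖p.toAddCircle x‖ + w x * Real.log (1 + A)) ∂haarAddCircle ≤
      ∫ x, (‖p.toAddCircle x‖ + A * (‖p.toAddCircle x‖ * w x) - 1) ∂haarAddCircle := by
    refine integral_mono_ae (hint.add (hwi.mul_const _))
      ((hpi.add (hpwi.const_mul A)).sub (integrable_const _)) ?_
    filter_upwards [hne, hw0, hw1] with x hx h0 h1
    have hpos : 0 < ‖p.toAddCircle x‖ := norm_pos_iff.2 hx
    have hA1 : 0 < (1 + A) ^ w x := Real.rpow_pos_of_pos (by linarith) _
    have hb := rpow_one_add_le_one_add_mul_self (by linarith : -1 ≤ A) h0 h1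
    have hl := Real.log_le_sub_one_of_pos (mul_pos hpos hA1)
    rw [Real.log_mul hpos.ne' hA1.ne', Real.log_rpow (by linarith)] at hl
    have := mul_le_mul_of_nonneg_left hb hpos.le
    linarith
  rw [integral_add hint (hwi.mul_const _), integral_mul_const,
    integral_sub (f := fun x => ‖p.toAddCircle x‖ + A * (‖p.toAddCircle x‖ * w x))
      (hpi.add (hpwi.const_mul A)) (integrable_const _),
    integral_add hpi (hpwi.const_mul A), integral_const_mul] at key
  simp only [integral_const, probReal_univ, smul_eq_mul, one_mul] at key
  linarith

open Polynomial Filter in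
/-- A function in the unit ball of `L^∞` is unimodular if its norm as a functional on polynomials is
one and is approached along polynomials whose constant terms stay away from zero. -/
theorem ae_norm_eq_one_of_extremal {k : AddCircle (2 * π) → ℂ}
    (hkm : AEStronglyMeasurable k haarAddCircle) (hk : ∀ᵐ x ∂haarAddCircle, ‖k x‖ ≤ 1)
    {r : ℝ} (hr : 0 < r)
    (h : ∀ η < 1, ∃ p : ℂ[X], ∫ x, ‖p.toAddCircle x‖ ∂haarAddCircle ≤ 1 ∧ r ≤ ‖p.coeff 0‖ ∧
      η < ‖∫ x, k x * p.toAddCircle x ∂haarAddCircle‖) :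
    ∀ᵐ x ∂haarAddCircle, ‖k x‖ = 1 := by
  have hwm : AEStronglyMeasurable (fun x => 1 - ‖k x‖) haarAddCircle :=
    aestronglyMeasurable_const.sub hkm.norm
  have hw0 : ∀ᵐ x ∂haarAddCircle, 0 ≤ 1 - ‖k x‖ := by
    filter_upwards [hk] with x hx using sub_nonneg.2 hx
  have hw1 : ∀ᵐ x ∂(haarAddCircle (T := 2 * π)), 1 - ‖k x‖ ≤ 1 :=
    .of_forall fun x => by simp
  have hwi : Integrable (fun x => 1 - ‖k x‖) haarAddCircle :=
    (integrable_const _).sub ((Integrable.of_bound hkm 1 hk).norm)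
  have hA (A : ℝ) (hA0 : 0 ≤ A) :
      (∫ x, (1 - ‖k x‖) ∂haarAddCircle) * Real.log (1 + A) ≤ - Real.log r := by
    have hε (ε : ℝ) (hε0 : 0 < ε) :
        (∫ x, (1 - ‖k x‖) ∂haarAddCircle) * Real.log (1 + A) ≤ - Real.log r + A * ε := by
      obtain ⟨p, hp1, hpr, hpη⟩ := h (1 - ε) (by linarith)
      have hp0 : 0 < ‖p.coeff 0‖ := hr.trans_le hpr
      have h1 := log_norm_coeff_zero_add_integral_mul_log_le p (norm_pos_iff.1 hp0) hwm hw0 hw1 hA0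
      have h2 := Real.log_le_log hr hpr
      have hpi : Integrable (fun x => ‖p.toAddCircle x‖) (haarAddCircle (T := 2 * π)) :=
        (toAddCircle.integrable p).norm
      have hpk : Integrable (fun x => ‖k x * p.toAddCircle x‖) haarAddCircle :=
        ((toAddCircle.integrable p).bdd_mul (c := 1) hkm hk).norm
      have h3 : ∫ x, ‖p.toAddCircle x‖ * (1 - ‖k x‖) ∂haarAddCircle ≤ ε := by
        have h4 := norm_integral_le_integral_norm (μ := haarAddCircle)
          fun x => k x * p.toAddCircle x
        calc _ = ∫ x, (‖p.toAddCircle x‖ - ‖k x * p.toAddCircle x‖) ∂haarAddCircle := by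
              congr with x
              rw [norm_mul]
              ring
          _ ≤ ε := by rw [integral_sub hpi hpk]; linarith
      nlinarith
    refine le_of_forall_pos_le_add fun ε hε0 => (hε (ε / (A + 1)) (by positivity)).trans ?_
    gcongr
    rw [mul_div_assoc', div_le_iff₀ (by positivity)]
    nlinarith
  have hzero : ∫ x, (1 - ‖k x‖) ∂haarAddCircle = 0 := by
    refine le_antisymm ?_ (integral_nonneg_of_ae hw0)
    by_contra! hpos
    have ht : Tendsto (fun A : ℝ => (∫ x, (1 - ‖k x‖) ∂haarAddCircle) * Real.log (1 + A))
        atTop atTop :=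
      (Real.tendsto_log_atTop.comp (tendsto_atTop_add_const_left _ _ tendsto_id)).const_mul_atTop
        hpos
    obtain ⟨A, hA1, hA0⟩ :=
      ((ht.eventually_gt_atTop (- Real.log r)).and (eventually_ge_atTop 0)).exists
    exact (hA A hA0).not_gt hA1
  filter_upwards [(integral_eq_zero_iff_of_nonneg_ae hw0 hwi).1 hzero] with x hx
  simp only [Pi.zero_apply] at hx
  linarith

open Polynomial in
/-- Every function in the open unit ball of `L^∞` shares its negative Fourier coefficients with a
unimodular function. -/
theorem exists_unimodular_of_norm_lt_one (u : Lp ℂ ⊤ (haarAddCircle (T := 2 * π)))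
    (hu : ‖u‖ < 1) :
    ∃ k : AddCircle (2 * π) → ℂ, AEStronglyMeasurable k haarAddCircle ∧
      (∀ᵐ x ∂haarAddCircle, ‖k x‖ = 1) ∧
      ∀ n : ℕ, n ≠ 0 → ∫ x, k x * fourier n x ∂haarAddCircle =
        ∫ x, u x * fourier n x ∂haarAddCircle := by
  let T : ℂ[X] →ₗ[ℂ] Lp ℂ 1 (haarAddCircle (T := 2 * π)) :=
    (ContinuousMap.toLp 1 haarAddCircle ℂ).toLinearMap ∘ₗ toAddCircle.toLinearMap
  have hT (p : ℂ[X]) : ‖T p‖ = ∫ x, ‖p.toAddCircle x‖ ∂haarAddCircle := by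
    rw [L1.norm_eq_integral_norm]
    refine integral_congr_ae ?_
    filter_upwards [ContinuousMap.coeFn_toLp (p := 1) (𝕜 := ℂ) haarAddCircle p.toAddCircle]
      with x hx
    exact congrArg norm hx
  have hub : ∀ᵐ x ∂haarAddCircle, ‖u x‖ ≤ ‖u‖ := by
    filter_upwards [ae_le_eLpNormEssSup (f := u) (μ := haarAddCircle)] with x hx
    rw [Lp.norm_def, eLpNorm_exponent_top, ← toReal_enorm]
    exact ENNReal.toReal_mono (by simpa using Lp.eLpNorm_ne_top u) hx
  have hui (p : ℂ[X]) : Integrable (fun x => u x * p.toAddCircle x) haarAddCircle :=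
    (toAddCircle.integrable p).bdd_mul (c := ‖u‖) (Lp.aestronglyMeasurable u) hub
  let ψ : ℂ[X] →ₗ[ℂ] ℂ :=
    { toFun p := ∫ x, u x * p.toAddCircle x ∂haarAddCircle
      map_add' p q := by
        rw [← integral_add (hui p) (hui q)]
        simp [mul_add]
      map_smul' c p := by
        rw [RingHom.id_apply, smul_eq_mul, ← integral_const_mul]
        simp [mul_left_comm] }
  have hψ (p : ℂ[X]) : ‖ψ p‖ ≤ ‖u‖ * ‖T p‖ := by
    rw [hT, ← integral_const_mul]
    refine norm_integral_le_of_norm_le ((toAddCircle.integrable p).norm.const_mul _) ?_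
    filter_upwards [hub] with x hx
    rw [norm_mul]
    gcongr
  have he (p : ℂ[X]) : ‖p.coeff 0‖ ≤ ‖T p‖ := by
    rw [hT]
    have h := fourierCoeff_toAddCircle_natCast p 0
    simp only [fourierCoeff, Nat.cast_zero, neg_zero, fourier_zero, one_smul] at h
    rw [← h]
    exact norm_integral_le_integral_norm _
  obtain ⟨c, hc, r, hr, hext⟩ := exists_extremal_perturbation ((normSeminorm ℂ _).comp T) ψ
    (lcoeff ℂ 0) hu hψ he 1 (by simp)
  obtain ⟨Λ, hΛ, hΛT⟩ := exists_dual_comp_eq_of_norm_le T (ψ + c • lcoeff ℂ 0) hc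
  obtain ⟨k, hkm, hk1, hk⟩ := exists_ae_norm_le_one_repr Λ hΛ
  have hkp (p : ℂ[X]) : ∫ x, k x * p.toAddCircle x ∂haarAddCircle = ψ p + c * p.coeff 0 := by
    have hp : MemLp p.toAddCircle 2 (haarAddCircle (T := 2 * π)) :=
      (Lp.memLp (ContinuousMap.toLp 2 haarAddCircle ℂ p.toAddCircle)).ae_eq
        (ContinuousMap.coeFn_toLp _ _)
    rw [← hk _ hp]
    exact hΛT p
  refine ⟨k, hkm, ae_norm_eq_one_of_extremal hkm hk1 hr fun η hη => ?_, fun n hn => ?_⟩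
  · obtain ⟨p, hp1, hpr, hpη⟩ := hext η hη
    exact ⟨p, (hT p).symm.trans_le hp1, hpr, by rw [hkp]; exact hpη⟩
  · have := hkp (X ^ n)
    rw [toAddCircle_X_pow_eq_fourier, coeff_X_pow, if_neg hn.symm, mul_zero, add_zero] at this
    rw [this, ← toAddCircle_X_pow_eq_fourier]
    rfl

/-- **Adamjan–Arov–Krein theorem.** If `f ∈ L^∞(𝕋)` satisfies `dist(f, H^∞(𝕋)) < 1`, then the
coset `f + H^∞(𝕋)` contains a unimodular function. -/
theorem adamjan_arov_krein (f : Lp ℂ ⊤ (haarAddCircle : Measure (AddCircle (2*π))))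
    (h : Metric.infDist f Hinf < 1) :
    ∃ g ∈ Hinf, ∀ᵐ x ∂(haarAddCircle : Measure (AddCircle (2*π))), ‖(f + g) x‖ = 1 := by
  have h0 : (0 : Lp ℂ ⊤ (haarAddCircle : Measure (AddCircle (2*π)))) ∈ Hinf := fun n _ => by
    rw [fourierCoeff_congr_ae (Lp.coeFn_zero ℂ ⊤ haarAddCircle)]
    simp [fourierCoeff]
  obtain ⟨g, hg, hfg⟩ := (Metric.infDist_lt_iff ⟨0, h0⟩).1 h
  rw [dist_eq_norm] at hfg
  obtain ⟨k, hkm, hk1, hk⟩ := exists_unimodular_of_norm_lt_one (f - g) hfg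
  have hkL : MemLp k ⊤ haarAddCircle := .of_bound hkm 1 (hk1.mono fun _ hx => hx.le)
  have hint (v : Lp ℂ ⊤ (haarAddCircle : Measure (AddCircle (2*π)))) : Integrable v haarAddCircle :=
    (Lp.memLp v).integrable le_top
  have hcoeff (n : ℤ) (hn : n < 0) : fourierCoeff (hkL.toLp k) n =
      fourierCoeff (f - g : Lp ℂ ⊤ _) n := by
    obtain ⟨m, rfl⟩ : ∃ m : ℕ, n = -m := ⟨n.natAbs, by omega⟩
    have := hk m (by omega)
    rw [fourierCoeff_congr_ae hkL.coeFn_toLp]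
    simpa [fourierCoeff, mul_comm] using this
  refine ⟨hkL.toLp k - f, fun n hn => ?_, ?_⟩
  · have h1 : hkL.toLp k - f = (hkL.toLp k - (f - g)) - g := by abel
    have hadd (u v : Lp ℂ ⊤ (haarAddCircle : Measure (AddCircle (2*π)))) :
        fourierCoeff (u + v : Lp ℂ ⊤ _) n = fourierCoeff u n + fourierCoeff v n := by
      rw [fourierCoeff_congr_ae (Lp.coeFn_add u v), fourierCoeff.add (hint u) (hint v)]
      rfl
    have h2 := hadd (hkL.toLp k - f) f
    have h3 := hadd (f - g) g
    rw [sub_add_cancel] at h2 h3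
    rw [hcoeff n hn, h3, hg n hn, add_zero] at h2
    simpa using h2
  · rw [add_sub_cancel]
    filter_upwards [hkL.coeFn_toLp, hk1] with x hx hx1
    rw [hx, hx1]
end
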